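/- For every integer s ≥ 2, the maximum number of edges of a finite simple graph G with maximum degree Δ(G) < s and matching number ν(G) < s equals s(s-1) if s is odd, and equals ⌊(2s-1)(s-1)/2⌋ if s is even. -/

import Mathlib

open SimpleGraph

/-- `M` is a matching of `G`: a set of edges of `G` that are pairwise vertex-disjoint. -/
def IsMatchingSet {V : Type} (G : SimpleGraph V) (M : Set (Sym2 V)) : Prop :=
  M ⊆ G.edgeSet ∧ M.Pairwise fun e f => ∀ v : V, v ∈ e → v ∉ f

/-- The matching number `ν(G)`: the maximum size of a matching in `G`. -/
noncomputable def nu {V : Type} (G : SimpleGraph V) : ℕ :=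
  sSup {n | ∃ M : Set (Sym2 V), IsMatchingSet G M ∧ M.ncard = n}

/-- `v` is saturated (covered) by the matching `M`. -/
def MSaturates {V : Type} (M : Set (Sym2 V)) (v : V) : Prop := ∃ e ∈ M, v ∈ e

/-- The edges of the walk `p` alternate: the `i`-th edge belongs to `M` iff `i` is odd
(so the walk starts with a non-matching edge). -/
def IsAlternating {V : Type} (M : Set (Sym2 V)) {G : SimpleGraph V} {a b : V}
    (p : G.Walk a b) : Prop :=
  ∀ (i : ℕ) (h : i < p.edges.length), (p.edges[i]'h ∈ M ↔ Odd i)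

/-- A star path of `G` relative to `M`: a path of even length, alternating starting with a
non-matching edge, whose initial vertex is `M`-unsaturated. -/
def IsStarPath {V : Type} (M : Set (Sym2 V)) {G : SimpleGraph V} {a b : V}
    (p : G.Walk a b) : Prop :=
  p.IsPath ∧ Even p.length ∧ ¬ MSaturates M a ∧ IsAlternating M p

/-- `v` is a star vertex of `G` relative to `M`: some star path terminates at `v`. -/
def IsStarVertex {V : Type} (G : SimpleGraph V) (M : Set (Sym2 V)) (v : V) : Prop :=
  ∃ a : V, ∃ p : G.Walk a v, IsStarPath M p

/-- An `M`-augmenting path: a path of odd length, alternating starting and ending with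
non-matching edges, both of whose endpoints are `M`-unsaturated. -/
def IsAugPath {V : Type} (M : Set (Sym2 V)) {G : SimpleGraph V} {a b : V}
    (p : G.Walk a b) : Prop :=
  p.IsPath ∧ Odd p.length ∧ ¬ MSaturates M a ∧ ¬ MSaturates M b ∧ IsAlternating M p

/-- `G ∈ F(d,m)`: `G` is a finite simple graph with maximum degree `< d` and matching
number `< m`, edge-maximal with this property among all finite graphs on vertex sets
containing `V(G)`. -/
def MemF (d m : ℕ) {V : Type} [Fintype V] (G : SimpleGraph V) : Prop :=
  (∀ v : V, (G.neighborSet v).ncard < d) ∧ nu G < m ∧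
  ∀ (W : Type) [Fintype W] (f : V ↪ W) (G' : SimpleGraph W),
    (∀ u v : V, G.Adj u v → G'.Adj (f u) (f v)) →
    G.edgeSet.ncard < G'.edgeSet.ncard →
    (∃ w : W, d ≤ (G'.neighborSet w).ncard) ∨ m ≤ nu G'

lemma IsMatchingSet.mono {V : Type} {G : SimpleGraph V} {M N : Set (Sym2 V)}
    (hM : IsMatchingSet G M) (hN : N ⊆ M) : IsMatchingSet G N :=
  ⟨hN.trans hM.1, hM.2.mono hN⟩

namespace SimpleGraph

variable {V : Type}

lemma sum_ncard_neighborSet [Fintype V] (G : SimpleGraph V) :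
    ∑ v, (G.neighborSet v).ncard = 2 * G.edgeSet.ncard := by
  classical
  have h := G.sum_degrees_eq_twice_card_edges
  rw [← Set.ncard_coe_finset, coe_edgeFinset] at h
  rw [← h]
  refine Finset.sum_congr rfl fun v _ => ?_
  rw [Set.ncard_eq_toFinset_card', ← card_neighborFinset_eq_degree]
  rfl

lemma ncard_neighborSet_eq_sum [Fintype V] (G : SimpleGraph V) [DecidableRel G.Adj] (v : V) :
    (G.neighborSet v).ncard = ∑ w, if G.Adj v w then 1 else 0 := by
  rw [← Finset.card_filter, ← Set.ncard_coe_finset]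
  simp [neighborSet]

lemma ncard_saturated [Finite V] {G : SimpleGraph V} {M : Set (Sym2 V)}
    (hM : IsMatchingSet G M) : {v | MSaturates M v}.ncard = 2 * M.ncard := by
  classical
  cases nonempty_fintype V
  have h : {v | MSaturates M v} = (M.toFinset.biUnion Sym2.toFinset : Finset V) := by
    ext v
    simp [MSaturates]
  rw [h, Set.ncard_coe_finset, Finset.card_biUnion, Set.ncard_eq_toFinset_card',
    Finset.sum_congr rfl (g := fun _ => 2), Finset.sum_const, smul_eq_mul, mul_comm]
  · intro e he
    exact Sym2.card_toFinset_of_not_isDiag e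
      (G.not_isDiag_of_mem_edgeSet (hM.1 (by simpa using he)))
  · intro e he f hf hef
    refine Finset.disjoint_left.2 fun v hv => ?_
    simpa using hM.2 (by simpa using he) (by simpa using hf) hef v (by simpa using hv)

lemma two_mul_ncard_le_of_saturated_subset [Finite V] {G : SimpleGraph V} {M : Set (Sym2 V)}
    (hM : IsMatchingSet G M) {A : Set V} (hA : ∀ e ∈ M, ∀ v ∈ e, v ∈ A) :
    2 * M.ncard ≤ A.ncard := by
  rw [← ncard_saturated hM]
  exact Set.ncard_le_ncard fun v ⟨e, he, hv⟩ => hA e he v hv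

lemma nu_lt_iff [Finite V] {G : SimpleGraph V} {m : ℕ} :
    nu G < m ↔ ∀ M, IsMatchingSet G M → M.ncard < m := by
  have hb : BddAbove {n | ∃ M : Set (Sym2 V), IsMatchingSet G M ∧ M.ncard = n} := by
    refine ⟨(Set.univ : Set (Sym2 V)).ncard, ?_⟩
    rintro _ ⟨M, -, rfl⟩
    exact Set.ncard_le_ncard (Set.subset_univ M)
  constructor
  · exact fun h M hM => (le_csSup hb ⟨M, hM, rfl⟩).trans_lt h
  · intro h
    have hne : {n | ∃ M : Set (Sym2 V), IsMatchingSet G M ∧ M.ncard = n}.Nonempty :=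
      ⟨0, ∅, ⟨Set.empty_subset _, Set.pairwise_empty _⟩, Set.ncard_empty _⟩
    obtain ⟨M, hM, hn⟩ := Nat.sSup_mem hne hb
    rw [nu, ← hn]
    exact h M hM

lemma Iso.ncard_oddComponents {W : Type*} {G : SimpleGraph V} {H : SimpleGraph W} (φ : G ≃g H) :
    G.oddComponents.ncard = H.oddComponents.ncard := by
  refine Nat.card_congr (φ.connectedComponentEquiv.subtypeEquiv fun C => ?_)
  have : C.supp.ncard = (φ.connectedComponentEquiv C).supp.ncard :=
    Nat.card_congr (ConnectedComponent.isoEquivSupp φ C)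
  simp [oddComponents, this]

/-- The join of `G` with a complete graph on `d` new vertices. -/
def joinComplete (G : SimpleGraph V) (d : ℕ) : SimpleGraph (V ⊕ Fin d) where
  Adj x y := x ≠ y ∧ ∀ u v, x = .inl u → y = .inl v → G.Adj u v
  symm := ⟨fun _ _ h => ⟨h.1.symm, fun u v hu hv => (h.2 v u hv hu).symm⟩⟩
  loopless := ⟨fun _ h => h.1 rfl⟩

lemma joinComplete_adj_inl {G : SimpleGraph V} {d : ℕ} {u v : V} :
    (G.joinComplete d).Adj (.inl u) (.inl v) ↔ G.Adj u v := by
  simp only [joinComplete, Sum.inl.injEq]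
  exact ⟨fun h => h.2 u v rfl rfl, fun h => ⟨by simpa using h.ne, by rintro _ _ rfl rfl; exact h⟩⟩

lemma joinComplete_adj_inr {G : SimpleGraph V} {d : ℕ} {i : Fin d} {x : V ⊕ Fin d}
    (hx : .inr i ≠ x) : (G.joinComplete d).Adj (.inr i) x :=
  ⟨hx, by simp⟩

lemma exists_matchingSet_of_joinComplete [Finite V] {G : SimpleGraph V} {d : ℕ}
    {P : (G.joinComplete d).Subgraph} (hP : P.IsPerfectMatching) :
    ∃ M, IsMatchingSet G M ∧ Nat.card V ≤ 2 * M.ncard + d := by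
  rw [Subgraph.isPerfectMatching_iff] at hP
  let M : Set (Sym2 V) := {e | e.map .inl ∈ P.edgeSet}
  have hmem (u v : V) : s(u, v) ∈ M ↔ P.Adj (.inl u) (.inl v) := by simp [M]
  have hM : IsMatchingSet G M := by
    constructor
    · intro e
      induction e with | _ u v => exact fun h => joinComplete_adj_inl.1 ((hmem u v).1 h).adj_sub
    · intro e he f hf hef v hve hvf
      obtain ⟨x, rfl⟩ := Sym2.mem_iff_exists.1 hve
      obtain ⟨y, rfl⟩ := Sym2.mem_iff_exists.1 hvf
      have := (hP (.inl v)).unique ((hmem _ _).1 he) ((hmem _ _).1 hf)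
      simp_all
  refine ⟨M, hM, ?_⟩
  rw [← ncard_saturated hM, ← Set.ncard_add_ncard_compl {v | MSaturates M v}]
  gcongr
  choose g hg hgu using hP
  have hr (v : V) (hv : ¬ MSaturates M v) : ∃ i, g (.inl v) = .inr i := by
    rcases h : g (.inl v) with u | i
    · refine absurd ⟨s(v, u), ?_, by simp⟩ hv
      rw [hmem, ← h]
      exact hg _
    · exact ⟨i, rfl⟩
  calc _ ≤ (Set.range (.inr : Fin d → V ⊕ Fin d)).ncard := by
        refine Set.ncard_le_ncard_of_injOn (fun v => g (.inl v))
          (fun v hv => (hr v hv).imp fun _ => Eq.symm) fun u _ v _ h => ?_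
        replace h : g (.inl u) = g (.inl v) := h
        have := (hgu _ _ (hg (.inl u)).symm).trans (hgu _ _ (h ▸ (hg (.inl v)).symm)).symm
        simpa using this
    _ = d := by
        rw [← Set.image_univ, Set.ncard_image_of_injective _ Sum.inr_injective]
        simp

/-- A form of the Tutte–Berge formula. -/
lemma exists_ncard_add_card_le [Finite V] {G : SimpleGraph V} {k : ℕ}
    (hn : 2 * k + 2 ≤ Nat.card V) (hk : ∀ M, IsMatchingSet G M → M.ncard ≤ k) :
    ∃ S : Set V, S.ncard + Nat.card V ≤ 2 * k + (G.induce Sᶜ).oddComponents.ncard := by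
  obtain ⟨d, hd⟩ := Nat.exists_eq_add_of_le hn
  have hno : ¬ ∃ P : (G.joinComplete d).Subgraph, P.IsPerfectMatching := by
    rintro ⟨P, hP⟩
    obtain ⟨M, hM, h⟩ := exists_matchingSet_of_joinComplete hP
    have := hk M hM
    omega
  rw [tutte] at hno
  push Not at hno
  obtain ⟨T, hT⟩ := hno
  rw [IsTutteViolator] at hT
  set K := ((⊤ : (G.joinComplete d).Subgraph).deleteVerts T).coe with hK
  have hcard : Nat.card ((⊤ : (G.joinComplete d).Subgraph).deleteVerts T).verts + T.ncard
      = Nat.card V + d := by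
    have h := Set.ncard_add_ncard_compl T
    rw [Nat.card_sum, Nat.card_fin] at h
    rw [← h, add_comm]
    congr 1
    rw [← Nat.card_coe_set_eq]
    simp [Set.compl_eq_univ_sdiff]
  have hpar := odd_ncard_oddComponents K
  have hT2 : T.ncard + 2 ≤ K.oddComponents.ncard := by
    by_contra hlt
    have : K.oddComponents.ncard = T.ncard + 1 := by omega
    rw [this] at hpar
    grind
  have hall (i : Fin d) : .inr i ∈ T := by
    by_contra hi
    have hconn : K.Preconnected := by
      have hi' : .inr i ∈ ((⊤ : (G.joinComplete d).Subgraph).deleteVerts T).verts := by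
        simpa using hi
      have this (x) : K.Reachable ⟨.inr i, hi'⟩ x := by
        by_cases hx : .inr i = x.1
        · have : ⟨.inr i, hi'⟩ = x := Subtype.ext hx
          rw [this]
        · refine Adj.reachable ?_
          have := x.2
          simp only [Subgraph.induce_verts, Subgraph.verts_top, Set.mem_sdiff] at this
          simp [hK, hi, this, joinComplete_adj_inr hx]
      exact fun x y => (this x).symm.trans (this y)
    have := hconn.subsingleton_connectedComponent
    have : K.oddComponents.ncard ≤ 1 := Set.ncard_le_one_of_subsingleton _
    omega
  refine ⟨Sum.inl ⁻¹' T, ?_⟩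
  have hTS : T.ncard = (Sum.inl ⁻¹' T : Set V).ncard + d := by
    have : T = Sum.inl '' (Sum.inl ⁻¹' T : Set V) ∪ Sum.inr '' (Set.univ : Set (Fin d)) := by
      ext (x | x) <;> simp [hall]
    conv_lhs => rw [this]
    rw [Set.ncard_union_eq, Set.ncard_image_of_injective _ Sum.inl_injective,
      Set.ncard_image_of_injective _ Sum.inr_injective]
    · simp
    · rw [Set.disjoint_left]
      rintro _ ⟨x, -, rfl⟩ ⟨y, -, h⟩
      cases h
  have hcomp : (G.induce (Sum.inl ⁻¹' T : Set V)ᶜ).oddComponents.ncard =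
      K.oddComponents.ncard := by
    let f : ((Sum.inl ⁻¹' T : Set V)ᶜ : Set V) →
        ((⊤ : (G.joinComplete d).Subgraph).deleteVerts T).verts :=
      fun v => ⟨.inl v.1, by have h : Sum.inl v.1 ∉ T := v.2; simpa using h⟩
    refine Iso.ncard_oddComponents ⟨Equiv.ofBijective f ⟨?_, ?_⟩, ?_⟩
    · intro u v h
      simpa [f, Subtype.ext_iff] using h
    · rintro ⟨x | i, hx⟩
      · exact ⟨⟨x, by simpa using hx⟩, rfl⟩
      · simp [hall] at hx
    · rintro ⟨u, hu⟩ ⟨v, hv⟩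
      have hu' : Sum.inl u ∉ T := hu
      have hv' : Sum.inl v ∉ T := hv
      change K.Adj (f _) (f _) ↔ G.Adj u v
      simp [f, hK, hu', hv', joinComplete_adj_inl]
  omega

lemma ncard_neighborSet_lt_ncard_supp [Finite V] (G : SimpleGraph V) (v : V) :
    (G.neighborSet v).ncard < (G.connectedComponentMk v).supp.ncard := by
  refine Set.ncard_lt_ncard ⟨fun w hw => ?_, fun h => G.loopless.irrefl v (h (by simp))⟩
  exact (ConnectedComponent.connectedComponentMk_eq_of_adj hw).symm

private lemma mul_le_two_mul_mul_half_add {c d k : ℕ} (hc : d < c) (hk : d ≤ k) :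
    c * d ≤ 2 * k * (c / 2) + k * if Odd c ∧ k + 1 ≤ c then 1 else 0 := by
  obtain ⟨m, rfl | rfl⟩ := Nat.even_or_odd' c
  · have : 2 * m / 2 = m := by omega
    rw [this]
    exact le_add_right (by nlinarith)
  · have : (2 * m + 1) / 2 = m := by omega
    rw [this]
    split_ifs with h
    · nlinarith
    · have : 2 * m + 1 ≤ k := by
        by_contra hlt
        exact h ⟨by simp, by omega⟩
      nlinarith

/-- A graph of maximum degree at most `k` whose components contain in total at most `m` disjoint
pairs of vertices has at most `k * m + k * q / 2` edges, where `q` is the number of odd components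
with more than `k` vertices. -/
lemma exists_two_mul_ncard_edgeSet_le [Finite V] {G : SimpleGraph V} {k : ℕ}
    (hk : ∀ v, (G.neighborSet v).ncard ≤ k) :
    ∃ m q, 2 * m + G.oddComponents.ncard = Nat.card V ∧ q * ((k + 1) / 2) ≤ m ∧
      2 * G.edgeSet.ncard ≤ 2 * k * m + k * q := by
  classical
  cases nonempty_fintype V
  have hcard (C : G.ConnectedComponent) :
      C.supp.ncard = Finset.card {v | G.connectedComponentMk v = C} := by
    rw [← Set.ncard_coe_finset]
    congr 1
    ext v
    simp
  refine ⟨∑ C : G.ConnectedComponent, C.supp.ncard / 2,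
    ∑ C : G.ConnectedComponent, if Odd C.supp.ncard ∧ k + 1 ≤ C.supp.ncard then 1 else 0,
    ?_, ?_, ?_⟩
  · have h1 : G.oddComponents.ncard = ∑ C : G.ConnectedComponent, C.supp.ncard % 2 := by
      rw [Set.ncard_eq_toFinset_card', Set.toFinset_ofPred, Finset.card_filter]
      refine Finset.sum_congr rfl fun C _ => ?_
      grind
    rw [h1, Finset.mul_sum, ← Finset.sum_add_distrib, Nat.card_eq_fintype_card, ← Finset.card_univ,
      Finset.card_eq_sum_card_fiberwise (f := G.connectedComponentMk) (t := Finset.univ) (by simp)]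
    refine Finset.sum_congr rfl fun C _ => ?_
    rw [Nat.div_add_mod, hcard]
  · rw [Finset.sum_mul]
    refine Finset.sum_le_sum fun C _ => ?_
    split_ifs with h
    · grind
    · simp
  · rw [← sum_ncard_neighborSet, Finset.mul_sum, Finset.mul_sum, ← Finset.sum_add_distrib,
      ← Finset.sum_fiberwise Finset.univ G.connectedComponentMk]
    refine Finset.sum_le_sum fun C _ => ?_
    have hpos : 0 < C.supp.ncard := (Set.ncard_pos).2 C.nonempty_supp
    refine le_trans ?_ (mul_le_two_mul_mul_half_add (d := min k (C.supp.ncard - 1))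
      (by omega) (min_le_left _ _))
    rw [hcard C, ← smul_eq_mul]
    refine Finset.sum_le_card_nsmul _ _ _ fun v hv => le_min (hk v) ?_
    have := G.ncard_neighborSet_lt_ncard_supp v
    rw [← hcard C]
    rw [(Finset.mem_filter.1 hv).2] at this
    omega

lemma ncard_edgeSet_le_add_induce_compl [Finite V] {G : SimpleGraph V} {k : ℕ}
    (hk : ∀ v, (G.neighborSet v).ncard ≤ k) (S : Set V) :
    G.edgeSet.ncard ≤ k * S.ncard + (G.induce Sᶜ).edgeSet.ncard := by
  classical
  cases nonempty_fintype V
  have hsub : G.edgeSet ⊆ (⋃ v ∈ S, (s(v, ·)) '' G.neighborSet v) ∪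
      Sym2.map Subtype.val '' (G.induce Sᶜ).edgeSet := by
    intro e
    induction e with | _ u v =>
    intro h
    by_cases hu : u ∈ S
    · exact .inl (Set.mem_biUnion hu ⟨v, h, rfl⟩)
    by_cases hv : v ∈ S
    · exact .inl (Set.mem_biUnion hv ⟨u, h.symm, Sym2.eq_swap⟩)
    · exact .inr ⟨s(⟨u, hu⟩, ⟨v, hv⟩), h, rfl⟩
  refine (Set.ncard_le_ncard hsub).trans ((Set.ncard_union_le _ _).trans ?_)
  refine add_le_add ?_ (Set.ncard_image_le)
  refine (S.toFinite.ncard_biUnion_le _).trans ?_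
  rw [finsum_mem_eq_finite_toFinset_sum _ S.toFinite, Set.ncard_eq_toFinset_card S, mul_comm,
    ← smul_eq_mul]
  exact Finset.sum_le_card_nsmul _ _ _ fun v _ => (Set.ncard_image_le).trans (hk v)

lemma exists_two_mul_ncard_edgeSet_le_of_matching [Finite V] {G : SimpleGraph V} {k : ℕ}
    (hn : 2 * k + 2 ≤ Nat.card V) (hk : ∀ v, (G.neighborSet v).ncard ≤ k)
    (hM : ∀ M, IsMatchingSet G M → M.ncard ≤ k) :
    ∃ q, q * ((k + 1) / 2) ≤ k ∧ 2 * G.edgeSet.ncard ≤ 2 * k * k + k * q := by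
  obtain ⟨S, hS⟩ := exists_ncard_add_card_le hn hM
  have hkS (v : (Sᶜ : Set V)) : ((G.induce Sᶜ).neighborSet v).ncard ≤ k := by
    refine le_trans ?_ (hk v)
    exact Set.ncard_le_ncard_of_injOn Subtype.val (fun w hw => hw) Subtype.val_injective.injOn
  obtain ⟨m, q, hm, hq, he⟩ := exists_two_mul_ncard_edgeSet_le hkS
  have h := ncard_edgeSet_le_add_induce_compl hk S
  have hc := Set.ncard_add_ncard_compl S
  rw [Nat.card_coe_set_eq] at hm
  have hmk : S.ncard + m ≤ k := by omega
  refine ⟨q, by omega, ?_⟩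
  nlinarith [Nat.mul_le_mul_left (2 * k) hmk]

lemma ncard_edgeSet_le [Fintype V] {G : SimpleGraph V} {k : ℕ} (hk1 : 1 ≤ k)
    (hk : ∀ v, (G.neighborSet v).ncard ≤ k) (hM : ∀ M, IsMatchingSet G M → M.ncard ≤ k) :
    G.edgeSet.ncard ≤ if Even k then (k + 1) * k else (2 * k + 1) * k / 2 := by
  have key : 2 * G.edgeSet.ncard ≤ if Even k then 2 * ((k + 1) * k) else (2 * k + 1) * k := by
    by_cases hn : 2 * k + 2 ≤ Nat.card V
    · obtain ⟨q, hq, he⟩ := exists_two_mul_ncard_edgeSet_le_of_matching hn hk hM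
      obtain ⟨t, rfl | rfl⟩ := Nat.even_or_odd' k
      · have h2 : (2 * t + 1) / 2 = t := by omega
        rw [h2] at hq
        have hq2 : q ≤ 2 := Nat.le_of_mul_le_mul_right hq (by omega)
        rw [if_pos (by simp)]
        nlinarith [Nat.mul_le_mul_left (2 * t) hq2]
      · have h2 : (2 * t + 1 + 1) / 2 = t + 1 := by omega
        rw [h2] at hq
        have hq1 : q ≤ 1 := by
          by_contra! hlt
          nlinarith
        rw [if_neg (by simp)]
        nlinarith [Nat.mul_le_mul_left (2 * t + 1) hq1]
    · rw [← sum_ncard_neighborSet]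
      have h : ∑ v, (G.neighborSet v).ncard ≤ Nat.card V * k := by
        rw [Nat.card_eq_fintype_card, ← Finset.card_univ, ← smul_eq_mul]
        exact Finset.sum_le_card_nsmul _ _ _ fun v _ => hk v
      have h' : Nat.card V * k ≤ (2 * k + 1) * k := Nat.mul_le_mul_right _ (by omega)
      split_ifs <;> nlinarith
  split_ifs at * <;> omega

/-- The disjoint union of two complete graphs on `n` vertices. -/
def twoCliques (n : ℕ) : SimpleGraph (Bool × Fin n) where
  Adj x y := x.1 = y.1 ∧ x.2 ≠ y.2
  symm := ⟨fun _ _ h => ⟨h.1.symm, h.2.symm⟩⟩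
  loopless := ⟨fun _ h => h.2 rfl⟩

lemma ncard_neighborSet_twoCliques {n : ℕ} (v : Bool × Fin n) :
    ((twoCliques n).neighborSet v).ncard = n - 1 := by
  have : (twoCliques n).neighborSet v = Prod.mk v.1 '' {v.2}ᶜ := by
    ext ⟨b, i⟩
    simp [twoCliques, eq_comm, and_comm]
  rw [this, Set.ncard_image_of_injective _ (Prod.mk_right_injective _), Set.ncard_compl]
  simp

lemma ncard_edgeSet_twoCliques (n : ℕ) : (twoCliques n).edgeSet.ncard = n * (n - 1) := by
  have h := sum_ncard_neighborSet (twoCliques n)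
  simp only [ncard_neighborSet_twoCliques, Finset.sum_const, Finset.card_univ,
    Fintype.card_prod, Fintype.card_bool, Fintype.card_fin, smul_eq_mul, mul_assoc] at h
  omega

lemma ncard_lt_of_isMatchingSet_twoCliques {n : ℕ} (hn : Odd n) {M : Set (Sym2 (Bool × Fin n))}
    (hM : IsMatchingSet (twoCliques n) M) : M.ncard < n := by
  let N (b : Bool) : Set (Sym2 (Bool × Fin n)) := {e ∈ M | ∀ v ∈ e, v.1 = b}
  have hN (b : Bool) : 2 * (N b).ncard ≤ n := by
    have h := two_mul_ncard_le_of_saturated_subset (hM.mono (Set.sep_subset _ _))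
      (A := Prod.mk b '' (Set.univ : Set (Fin n))) (M := N b)
      (fun e he v hv => ⟨v.2, trivial, by rw [← he.2 v hv]⟩)
    rwa [Set.ncard_image_of_injective _ (Prod.mk_right_injective _), Set.ncard_univ,
      Nat.card_fin] at h
  have hsub : M ⊆ N true ∪ N false := by
    intro e he
    have hadj := hM.1 he
    induction e with | _ u v =>
    have huv : u.1 = v.1 := hadj.1
    rcases h : v.1
    · right
      exact ⟨he, by simp [huv, h]⟩
    · left
      exact ⟨he, by simp [huv, h]⟩
  have h := (Set.ncard_le_ncard hsub).trans (Set.ncard_union_le _ _)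
  have ht := hN true
  have hf := hN false
  grind

/-- The complete bipartite graph with parts of size `n`, with `t` disjoint edges subdivided and all
`t` subdivision vertices identified. -/
def pinchedBipartite (n t : ℕ) : SimpleGraph (Option (Bool × Fin n)) where
  Adj x y := match x, y with
    | none, none => False
    | none, some y => y.2 < t
    | some x, none => x.2 < t
    | some x, some y => x.1 ≠ y.1 ∧ (x.2 = y.2 → t ≤ x.2)
  symm := ⟨by rintro (_ | x) (_ | y) <;> grind⟩
  loopless := ⟨by rintro (_ | x) <;> grind⟩

lemma ncard_neighborSet_pinchedBipartite_some {n t : ℕ} (v : Bool × Fin n) :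
    ((pinchedBipartite n t).neighborSet (some v)).ncard = n := by
  classical
  obtain ⟨b, i⟩ := v
  rw [ncard_neighborSet_eq_sum, Fintype.sum_option, Fintype.sum_prod_type, Fintype.sum_bool]
  have h (c : Bool) : (∑ j : Fin n, if (pinchedBipartite n t).Adj (some (b, i)) (some (c, j))
      then 1 else 0) = if b = c then 0 else if (i : ℕ) < t then n - 1 else n := by
    rw [← Finset.card_filter]
    split_ifs with hbc hi
    · simp [pinchedBipartite, hbc]
    · have : (Finset.univ.filter fun j : Fin n =>
          (pinchedBipartite n t).Adj (some (b, i)) (some (c, j))) = {i}ᶜ := by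
        ext j
        have : i = j → ¬ t ≤ (i : ℕ) := fun _ => by omega
        simp only [pinchedBipartite, Finset.mem_compl, Finset.mem_singleton]
        grind
      rw [this, Finset.card_compl]
      simp
    · simp [pinchedBipartite, hbc, not_lt.1 hi]
  have hn := i.pos
  rw [h, h]
  cases b <;> by_cases hi : (i : ℕ) < t <;> simp [pinchedBipartite, hi] <;> omega

lemma ncard_neighborSet_pinchedBipartite_none {n t : ℕ} (ht : t ≤ n) :
    ((pinchedBipartite n t).neighborSet none).ncard = 2 * t := by
  classical
  rw [ncard_neighborSet_eq_sum, Fintype.sum_option, Fintype.sum_prod_type, Fintype.sum_bool]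
  have h (b : Bool) : (∑ j : Fin n, if (pinchedBipartite n t).Adj none (some (b, j))
      then 1 else 0) = t := by
    rw [← Finset.card_filter]
    refine Eq.trans ?_ ((Fin.card_filter_val_lt (n := n) (m := t)).trans (min_eq_right ht))
    congr!
  rw [h, h]
  simp [two_mul]

lemma ncard_edgeSet_pinchedBipartite {n t : ℕ} (ht : t ≤ n) :
    (pinchedBipartite n t).edgeSet.ncard = n * n + t := by
  have h := sum_ncard_neighborSet (pinchedBipartite n t)
  rw [Fintype.sum_option, ncard_neighborSet_pinchedBipartite_none ht] at h
  simp only [ncard_neighborSet_pinchedBipartite_some, Finset.sum_const, Finset.card_univ,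
    Fintype.card_prod, Fintype.card_bool, Fintype.card_fin, smul_eq_mul, mul_assoc] at h
  omega

end SimpleGraph

/-- the maximum number of edges of a finite simple graph with `Δ < s` and
`ν < s` is `s(s-1)` for odd `s` and `⌊(2s-1)(s-1)/2⌋` for even `s`. -/
theorem stmt_12 {s : ℕ} (hs : 2 ≤ s) :
    IsGreatest
      {n : ℕ | ∃ (V : Type) (_ : Fintype V) (G : SimpleGraph V),
        (∀ v : V, (G.neighborSet v).ncard < s) ∧ nu G < s ∧ G.edgeSet.ncard = n}
      (if Odd s then s * (s - 1) else (2 * s - 1) * (s - 1) / 2) := by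
  obtain ⟨k, rfl⟩ : ∃ k, s = k + 1 := ⟨s - 1, by omega⟩
  have hval : (if Odd (k + 1) then (k + 1) * (k + 1 - 1)
      else (2 * (k + 1) - 1) * (k + 1 - 1) / 2) =
      if Even k then (k + 1) * k else (2 * k + 1) * k / 2 := by
    have h : 2 * (k + 1) - 1 = 2 * k + 1 := by omega
    simp [h, Nat.odd_add_one]
  rw [hval]
  constructor
  · split_ifs with hk
    · refine ⟨_, inferInstance, twoCliques (k + 1), fun v => ?_, nu_lt_iff.2 fun M hM => ?_, ?_⟩
      · rw [ncard_neighborSet_twoCliques]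
        omega
      · exact ncard_lt_of_isMatchingSet_twoCliques hk.add_one hM
      · exact ncard_edgeSet_twoCliques (k + 1)
    · obtain ⟨t, rfl⟩ := Nat.not_even_iff_odd.1 hk
      refine ⟨_, inferInstance, pinchedBipartite (2 * t + 1) t, ?_,
        nu_lt_iff.2 fun M hM => ?_, ?_⟩
      · rintro (_ | v)
        · rw [ncard_neighborSet_pinchedBipartite_none (by omega)]
          omega
        · rw [ncard_neighborSet_pinchedBipartite_some]
          omega
      · have h := two_mul_ncard_le_of_saturated_subset hM (A := Set.univ) (by simp)
        simp only [Set.ncard_univ, Nat.card_eq_fintype_card, Fintype.card_option,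
          Fintype.card_prod, Fintype.card_bool, Fintype.card_fin] at h
        omega
      · rw [ncard_edgeSet_pinchedBipartite (by omega)]
        refine (Nat.div_eq_of_lt_le ?_ ?_).symm <;> nlinarith
  · rintro _ ⟨V, _, G, hdeg, hnu, rfl⟩
    exact ncard_edgeSet_le (by omega) (fun v => Nat.le_of_lt_succ (hdeg v))
      fun M hM => Nat.le_of_lt_succ (nu_lt_iff.1 hnu M hM)
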